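/- Fix reals α > 2 and C with 0 < C ≤ 1/ζ(α), where ζ is the Riemann zeta function. For all sufficiently large integers n, any adjacency labeling scheme for the family of all n-vertex α-proper power-law graphs (with constant C) must assign, to some vertex of some graph in the family, a label of length at least ⌊i₁(n)/2⌋ bits. -/

import Mathlib

/-- The degree of a vertex `v` in a simple graph on `Fin n`. -/
noncomputable def deg {n : ℕ} (G : SimpleGraph (Fin n)) (v : Fin n) : ℕ :=
  (G.neighborSet v).ncard

/-- The number of vertices of `G` of degree exactly `k`. -/
noncomputable def Vcard {n : ℕ} (G : SimpleGraph (Fin n)) (k : ℕ) : ℕ :=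
  {v : Fin n | deg G v = k}.ncard

/-- `i₁(n)`: the smallest positive integer `i` with `⌊C·n / i^α⌋ ≤ 1`. -/
noncomputable def i1 (α C : ℝ) (n : ℕ) : ℕ :=
  sInf {i : ℕ | 0 < i ∧ ⌊C * (n : ℝ) / (i : ℝ) ^ α⌋ ≤ 1}

/-- `G` is an `α`-proper power-law graph with constant `C`. -/
def IsProperPowerLaw (α C : ℝ) {n : ℕ} (G : SimpleGraph (Fin n)) : Prop :=
  (⌊C * (n : ℝ)⌋ - (i1 α C n : ℤ) - 1 ≤ (Vcard G 1 : ℤ) ∧ (Vcard G 1 : ℤ) ≤ ⌈C * (n : ℝ)⌉) ∧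
  (⌊C * (n : ℝ) / (2 : ℝ) ^ α⌋ ≤ (Vcard G 2 : ℤ) ∧
    (Vcard G 2 : ℤ) ≤ ⌈C * (n : ℝ) / (2 : ℝ) ^ α⌉ + 1) ∧
  (∀ i : ℕ, 3 ≤ i → i ≤ n →
    (Vcard G i : ℤ) = ⌊C * (n : ℝ) / (i : ℝ) ^ α⌋ ∨
    (Vcard G i : ℤ) = ⌈C * (n : ℝ) / (i : ℝ) ^ α⌉) ∧
  (∀ i : ℕ, 2 ≤ i → i ≤ n - 1 → Vcard G (i + 1) ≤ Vcard G i)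

/-- The Riemann zeta function on reals: `ζ(s) = ∑_{k ≥ 1} k^(−s)`. -/
noncomputable def zetaR (s : ℝ) : ℝ := ∑' k : ℕ, ((k : ℝ) + 1) ^ (-s)

open Classical in
theorem deg_eq_degree {n : ℕ} (G : SimpleGraph (Fin n)) (v : Fin n)
    [Fintype (G.neighborSet v)] : deg G v = G.degree v := by
  rw [deg, Set.ncard_eq_toFinset_card', ← SimpleGraph.card_neighborFinset_eq_degree]
  rfl

open Classical in
theorem deg_eq_card {n : ℕ} (G : SimpleGraph (Fin n)) (v : Fin n)
    [Fintype (G.neighborSet v)] :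
    deg G v = (G.neighborFinset v).card := by
  rw [deg_eq_degree, SimpleGraph.card_neighborFinset_eq_degree]

open Classical in
theorem degree_sup_edge' {n : ℕ} (G : SimpleGraph (Fin n)) (a b : (Fin n)) (hab : a ≠ b)
    (hn : ¬ G.Adj a b) (w : (Fin n)) :
    deg (G ⊔ SimpleGraph.edge a b) w = deg G w + ((if w = a then 1 else 0) + (if w = b then 1 else 0)) := by
  have hn' : ¬ G.Adj b a := fun h => hn h.symm
  rw [deg_eq_card, deg_eq_card]
  by_cases h1 : w = a
  · subst h1
    have : (G ⊔ SimpleGraph.edge w b).neighborFinset w = insert b (G.neighborFinset w) := by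
      ext z
      simp [SimpleGraph.edge_adj]
      grind
    rw [this, Finset.card_insert_of_notMem (by simpa using hn)]
    simp [hab]
  · by_cases h2 : w = b
    · subst h2
      have : (G ⊔ SimpleGraph.edge a w).neighborFinset w = insert a (G.neighborFinset w) := by
        ext z
        simp [SimpleGraph.edge_adj]
        grind
      rw [this, Finset.card_insert_of_notMem (by simpa using hn')]
      simp [h1]
    · have : (G ⊔ SimpleGraph.edge a b).neighborFinset w = (G.neighborFinset w) := by
        ext z
        simp [SimpleGraph.edge_adj]
        grind
      rw [this]; simp [h1, h2]

open Classical in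
theorem realize {n : ℕ} (S : Finset (Fin n)) (H : SimpleGraph (Fin n))
    (t : (Fin n) → ℕ) (D : ℕ) (htD : ∀ v, t v ≤ D) (hHt : ∀ v, deg H v ≤ t v)
    (heven : Even (∑ v, t v))
    (hbig : (S.card + 2 * D + 2) * (D + 1) < (Finset.univ.filter (fun v => 1 ≤ t v)).card) :
    ∃ G : SimpleGraph (Fin n), (∀ u ∈ S, ∀ v ∈ S, (G.Adj u v ↔ H.Adj u v)) ∧ ∀ v, deg G v = t v := by
  let P : Finset (SimpleGraph (Fin n)) := Finset.univ.filter
    (fun G => (∀ u ∈ S, ∀ v ∈ S, (G.Adj u v ↔ H.Adj u v)) ∧ ∀ v, deg G v ≤ t v)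
  have hPne : P.Nonempty := ⟨H, by simp [P]; exact hHt⟩
  obtain ⟨G, hGP, hmax⟩ := Finset.exists_max_image P (fun G => ∑ v, deg G v) hPne
  have hG : (∀ u ∈ S, ∀ v ∈ S, (G.Adj u v ↔ H.Adj u v)) ∧ ∀ v, deg G v ≤ t v := by
    simpa [P] using hGP
  obtain ⟨hGS, hGt⟩ := hG
  have hmax' : ∀ G' : SimpleGraph (Fin n), (∀ u ∈ S, ∀ v ∈ S, (G'.Adj u v ↔ H.Adj u v)) →
      (∀ v, deg G' v ≤ t v) → ∑ v, deg G' v ≤ ∑ v, deg G v := by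
    intro G' h1 h2
    exact hmax G' (by simp [P]; exact ⟨h1, h2⟩)
  by_contra hcon
  have hex : ∃ u, deg G u < t u := by
    by_contra! h
    exact hcon ⟨G, hGS, fun v => le_antisymm (hGt v) (h v)⟩
  obtain ⟨u, hu⟩ := hex
  have hex2 : ∃ v, (v ≠ u ∧ deg G v < t v) ∨ (v = u ∧ deg G u + 2 ≤ t u) := by
    by_contra! h
    have hu1 : t u = deg G u + 1 := by have := (h u).2 rfl; omega
    have h2 : ∀ v, t v = deg G v + if v = u then 1 else 0 := by
      intro v
      by_cases hv : v = u
      · subst hv; simpa using hu1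
      · have := (h v).1 hv; have := hGt v; simp [hv]; omega
    have h3 : ∑ v, t v = ∑ v, deg G v + 1 := by
      rw [Finset.sum_congr rfl (fun v _ => h2 v), Finset.sum_add_distrib]; simp
    rw [h3, Finset.sum_congr rfl (fun v _ => deg_eq_degree G v), G.sum_degrees_eq_twice_card_edges] at heven
    have := Nat.even_iff.1 heven
    omega
  obtain ⟨v, hv⟩ := hex2
  have hvt : deg G v < t v := by
    rcases hv with h | ⟨h, h'⟩
    · exact h.2
    · subst h; omega
  let B : Finset (Fin n) := S ∪ (insert u (G.neighborFinset u) ∪ insert v (G.neighborFinset v))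
  have hBcard : B.card ≤ S.card + 2 * D + 2 := by
    have h1 := Finset.card_union_le S (insert u (G.neighborFinset u) ∪ insert v (G.neighborFinset v))
    have h2 := Finset.card_union_le (insert u (G.neighborFinset u)) (insert v (G.neighborFinset v))
    have h3 := Finset.card_insert_le u (G.neighborFinset u)
    have h4 := Finset.card_insert_le v (G.neighborFinset v)
    rw [← deg_eq_card] at h3 h4
    have := htD u; have := htD v
    have := hGt u; have := hGt v
    show (S ∪ _).card ≤ _
    omega
  have hBmem : ∀ x, x ∉ B → x ∉ S ∧ x ≠ u ∧ x ≠ v ∧ ¬ G.Adj u x ∧ ¬ G.Adj v x := by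
    intro x hx
    simp [B] at hx
    tauto
  -- outside B no residual
  have hres : ∀ x, x ∉ B → deg G x = t x := by
    intro x hx
    obtain ⟨hxS, hxu, hxv, hux, hvx⟩ := hBmem x hx
    by_contra hne
    have hlt := lt_of_le_of_ne (hGt x) hne
    have hd := degree_sup_edge' G u x hxu.symm hux
    have := hmax' (G ⊔ SimpleGraph.edge u x) (by
      intro a ha b hb
      rw [← hGS a ha b hb]
      simp [SimpleGraph.edge_adj]
      rintro (⟨rfl, rfl⟩ | ⟨rfl, rfl⟩) <;> contradiction) (by
      intro w
      rw [hd]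
      have := hGt w
      by_cases h1 : w = u
      · subst h1; simp [hxu.symm]; omega
      · by_cases h2 : w = x
        · subst h2; simp [hxu]; omega
        · simp [h1, h2]; omega)
    rw [Finset.sum_congr rfl (fun w _ => hd w)] at this
    simp [Finset.sum_add_distrib] at this
  -- every edge touches B
  have htouch : ∀ x y, G.Adj x y → x ∉ B → y ∈ B := by
    intro x y hxy hx
    by_contra hy
    obtain ⟨hxS, hxu, hxv, hux, hvx⟩ := hBmem x hx
    obtain ⟨hyS, hyu, hyv, huy, hvy⟩ := hBmem y hy
    have hxny := hxy.ne
    let G0 := G \ SimpleGraph.edge x y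
    have hG0 : G = G0 ⊔ SimpleGraph.edge x y := by
      ext a b
      simp [G0, SimpleGraph.edge_adj]
      grind [SimpleGraph.Adj.symm, SimpleGraph.Adj.ne]
    have hle : ∀ a b, G0.Adj a b → G.Adj a b := fun a b h => by
      simp [G0] at h; exact h.1
    have hd0 := degree_sup_edge' G0 x y hxny (by simp [G0, SimpleGraph.edge_adj, hxny])
    rw [← hG0] at hd0
    have hd1 := degree_sup_edge' G0 u x hxu.symm (fun h => hux (hle _ _ h))
    have hd2 := degree_sup_edge' (G0 ⊔ SimpleGraph.edge u x) v y hyv.symm (by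
      simp [SimpleGraph.edge_adj]
      refine ⟨fun h => hvy (hle _ _ h), ?_⟩
      grind)
    have hd : ∀ w, deg (G0 ⊔ SimpleGraph.edge u x ⊔ SimpleGraph.edge v y) w = deg G w
        + ((if w = u then 1 else 0) + (if w = v then 1 else 0)) := by
      intro w
      rw [hd2, hd1, hd0]
      omega
    have := hmax' (G0 ⊔ SimpleGraph.edge u x ⊔ SimpleGraph.edge v y) (by
      intro a ha b hb
      rw [← hGS a ha b hb]
      have h1 : a ≠ x := fun h => hxS (h ▸ ha)
      have h2 : a ≠ y := fun h => hyS (h ▸ ha)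
      have h3 : b ≠ x := fun h => hxS (h ▸ hb)
      have h4 : b ≠ y := fun h => hyS (h ▸ hb)
      simp [G0, SimpleGraph.edge_adj, h1, h2, h3, h4]) (by
      intro w
      rw [hd]
      have := hGt w
      by_cases h1 : w = u
      · subst h1
        by_cases h2 : w = v
        · subst h2
          simp; grind
        · simp [h2]; omega
      · by_cases h2 : w = v
        · subst h2; simp [h1]; omega
        · simp [h1, h2]; omega)
    rw [Finset.sum_congr rfl (fun w _ => hd w)] at this
    simp [Finset.sum_add_distrib] at this
  have hsub : (Finset.univ.filter (fun v => 1 ≤ t v)) ⊆ B ∪ B.biUnion (fun y => G.neighborFinset y) := by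
    intro x hx
    simp only [Finset.mem_filter, Finset.mem_univ, true_and] at hx
    by_cases hxB : x ∈ B
    · exact Finset.mem_union_left _ hxB
    · apply Finset.mem_union_right
      rw [← hres x hxB, deg_eq_card] at hx
      obtain ⟨y, hy⟩ := Finset.card_pos.1 hx
      rw [SimpleGraph.mem_neighborFinset] at hy
      rw [Finset.mem_biUnion]
      exact ⟨y, htouch x y hy hxB, by simpa using hy.symm⟩
  have h1 := Finset.card_le_card hsub
  have h2 := Finset.card_union_le B (B.biUnion (fun y => G.neighborFinset y))
  have h3 : (B.biUnion (fun y => G.neighborFinset y)).card ≤ B.card * D :=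
    Finset.card_biUnion_le_card_mul _ _ _ (fun y _ => by
      rw [← deg_eq_card]; exact (hGt y).trans (htD y))
  have h4 : B.card * (D+1) ≤ (S.card + 2 * D + 2) * (D+1) := Nat.mul_le_mul_right _ hBcard
  have h5 : B.card * (D+1) = B.card * D + B.card := by ring
  omega

theorem card_short_lists (m : ℕ) : Nat.card {l : List Bool // l.length < m} < 2 ^ m ∧
    Finite {l : List Bool // l.length < m} := by
  let f : {l : List Bool // l.length < m} → (Σ i : Fin m, List.Vector Bool i) :=
    fun l => ⟨⟨l.1.length, l.2⟩, ⟨l.1, rfl⟩⟩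
  have hf : Function.Injective f := by
    rintro ⟨a, ha⟩ ⟨b, hb⟩ h
    have h2 : (fun p : (Σ i : Fin m, List.Vector Bool i) => p.2.1) (f ⟨a, ha⟩)
      = (fun p : (Σ i : Fin m, List.Vector Bool i) => p.2.1) (f ⟨b, hb⟩) := by rw [h]
    exact Subtype.ext h2
  refine ⟨?_, Finite.of_injective f hf⟩
  have h1 := Nat.card_le_card_of_injective f hf
  rw [Nat.card_eq_fintype_card (α := (Σ i : Fin m, List.Vector Bool i)), Fintype.card_sigma] at h1
  simp only [card_vector, Fintype.card_bool] at h1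
  rw [Fin.sum_univ_eq_sum_range (fun i => 2 ^ i) m, Nat.geomSum_eq (le_refl 2)] at h1
  have : 0 < 2 ^ m := by positivity
  omega

theorem counting (k m : ℕ) (hm : 2 * m ≤ k) (D : List Bool → List Bool → Bool)
    (h : ∀ H : SimpleGraph (Fin (k + 1)), ∃ ℓ : Fin (k + 1) → List Bool,
      (∀ v, (ℓ v).length < m) ∧ ∀ u v, u ≠ v → (D (ℓ u) (ℓ v) = true ↔ H.Adj u v)) : False := by
  classical
  obtain ⟨hc, hfin⟩ := card_short_lists m
  let gr : (Set {e : Sym2 (Fin (k+1)) // ¬ e.IsDiag}) → SimpleGraph (Fin (k+1)) :=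
    fun s => SimpleGraph.fromEdgeSet (Subtype.val '' s)
  have hgr : Function.Injective gr := by
    intro s t hst
    have : (gr s).edgeSet = (gr t).edgeSet := by rw [hst]
    simp only [gr, SimpleGraph.edgeSet_fromEdgeSet] at this
    ext ⟨e, he⟩
    have h2 := Set.ext_iff.1 this e
    simpa [he] using h2
  choose L hL1 hL2 using h
  let F : (Set {e : Sym2 (Fin (k+1)) // ¬ e.IsDiag}) → (Fin (k+1) → {l : List Bool // l.length < m}) :=
    fun s v => ⟨L (gr s) v, hL1 (gr s) v⟩
  have hF : Function.Injective F := by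
    intro s t hst
    apply hgr
    have hL : L (gr s) = L (gr t) := by
      funext v
      exact congrArg Subtype.val (congrFun hst v)
    ext u v
    by_cases huv : u = v
    · subst huv; simp
    · rw [← hL2 _ u v huv, ← hL2 _ u v huv, hL]
  have h1 := Nat.card_le_card_of_injective F hF
  rw [Nat.card_fun, Nat.card_eq_fintype_card, Fintype.card_set, Sym2.card_subtype_not_diag,
    Nat.card_eq_fintype_card (α := Fin (k+1)), Fintype.card_fin] at h1
  have h2 := Nat.pow_lt_pow_left hc (Nat.succ_ne_zero k)
  rw [← pow_mul] at h2
  have h3 : 2 ^ (m * (k+1)) ≤ 2 ^ ((k+1).choose 2) := by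
    apply Nat.pow_le_pow_right (by norm_num)
    rw [Nat.choose_two_right, Nat.le_div_iff_mul_le (by norm_num)]
    simp only [Nat.add_sub_cancel]
    nlinarith
  exact absurd (h2.trans_le (h3.trans h1)) (lt_irrefl _)

theorem numeric (α C : ℝ) (hα : 2 < α) (hC : 0 < C) (hCz : C ≤ 1 / zetaR α) :
    ∃ N : ℕ, ∀ n : ℕ, N ≤ n → ∃ k : ℕ, k = i1 α C n ∧ 3 ≤ k ∧
      (∀ i : ℕ, 0 < i → i ≤ k → 1 ≤ ⌊C * (n : ℝ) / (i : ℝ) ^ α⌋₊) ∧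
      (∀ i : ℕ, 2 * k < i → ⌊C * (n : ℝ) / (i : ℝ) ^ α⌋₊ = 0) ∧
      ((5 * k + 3) * (2 * k + 1) + k + 2 ≤ ⌊C * (n : ℝ)⌋₊) ∧
      (∑ i ∈ Finset.Icc 1 (2 * k), ⌊C * (n : ℝ) / (i : ℝ) ^ α⌋₊ ≤ n) := by
  obtain ⟨B, hB1, hB2⟩ : ∃ B : ℕ, 2 * α + 3 ≤ B ∧ (25 : ℝ) ≤ (B : ℝ) ^ (α - 2) := by
    have h1 : Filter.Tendsto (fun B : ℕ => (B : ℝ)) Filter.atTop Filter.atTop :=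
      tendsto_natCast_atTop_atTop
    have h2 := (tendsto_rpow_atTop (show 0 < α - 2 by linarith)).comp h1
    obtain ⟨B, h⟩ := ((h1.eventually_ge_atTop (2 * α + 3)).and (h2.eventually_ge_atTop 25)).exists
    exact ⟨B, h.1, h.2⟩
  refine ⟨⌈2 * (B : ℝ) ^ α / C⌉₊, fun n hn => ?_⟩
  have hn' : 2 * (B : ℝ) ^ α ≤ C * n := by
    have := Nat.ceil_le.1 hn
    rw [div_le_iff₀ hC] at this
    linarith
  set k := i1 α C n with hk
  have hCn : 0 ≤ C * (n : ℝ) := by positivity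
  have hne : {i : ℕ | 0 < i ∧ ⌊C * (n : ℝ) / (i : ℝ) ^ α⌋ ≤ 1}.Nonempty := by
    have h1 : Filter.Tendsto (fun B : ℕ => (B : ℝ)) Filter.atTop Filter.atTop :=
      tendsto_natCast_atTop_atTop
    have h2 := (tendsto_rpow_atTop (show 0 < α by linarith)).comp h1
    obtain ⟨i, h3, h4⟩ := ((Filter.eventually_gt_atTop 0).and
      (h2.eventually_ge_atTop (C * n))).exists
    refine ⟨i, h3, ?_⟩
    have h5 : (0:ℝ) < (i : ℝ) ^ α := Real.rpow_pos_of_pos (by exact_mod_cast h3) _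
    have h6 : C * (n : ℝ) / (i : ℝ) ^ α ≤ 1 := by
      rw [div_le_one h5]; exact h4
    have := Int.floor_le_floor h6
    simpa using this
  have hmem : 0 < k ∧ ⌊C * (n : ℝ) / (k : ℝ) ^ α⌋ ≤ 1 := Nat.sInf_mem hne
  have hlt : ∀ i : ℕ, 0 < i → i < k → 2 * (i : ℝ) ^ α ≤ C * n := by
    intro i hi hik
    have h1 := Nat.notMem_of_lt_sInf hik
    simp only [Set.mem_ofPred_eq, not_and, not_le] at h1
    have h2 : (2 : ℤ) ≤ ⌊C * (n : ℝ) / (i : ℝ) ^ α⌋ := h1 hi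
    have h3 := Int.le_floor.1 h2
    have h5 : (0:ℝ) < (i : ℝ) ^ α := Real.rpow_pos_of_pos (by exact_mod_cast hi) _
    rw [le_div_iff₀ h5] at h3
    exact_mod_cast h3
  have hkpos : (0:ℝ) < (k : ℝ) := by exact_mod_cast hmem.1
  have hkα : (0:ℝ) < (k : ℝ) ^ α := Real.rpow_pos_of_pos hkpos _
  have hk2 : C * n < 2 * (k : ℝ) ^ α := by
    have h1 : ⌊C * (n : ℝ) / (k : ℝ) ^ α⌋ < 2 := by linarith [hmem.2]
    have h2 := Int.floor_lt.1 h1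
    rw [div_lt_iff₀ hkα] at h2
    exact_mod_cast h2
  have hBk : (B : ℝ) < k := by
    by_contra! h
    have := Real.rpow_le_rpow hkpos.le h (show 0 ≤ α by linarith)
    linarith
  have hk7 : (7:ℝ) ≤ k := by linarith
  have hk7' : 7 ≤ k := by exact_mod_cast hk7
  have hkC : (k : ℝ) ^ α ≤ C * n := by
    have h1 := hlt (k - 1) (by omega) (by omega)
    have h2 : ((k - 1 : ℕ) : ℝ) = k * (1 + (-1 / k)) := by
      rw [Nat.cast_sub (by omega)]; field_simp; simp; ring
    have h0 : (-1:ℝ) ≤ -1 / k := by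
      rw [le_div_iff₀ hkpos]; linarith
    rw [h2, Real.mul_rpow hkpos.le (by linarith)] at h1
    have h3 := one_add_mul_self_le_rpow_one_add h0 (show 1 ≤ α by linarith)
    have h4 : (1/2 : ℝ) ≤ 1 + α * (-1 / k) := by
      have : α / k ≤ 1 / 2 := by rw [div_le_iff₀ hkpos]; linarith
      have h5 : α * (-1 / k) = - (α / k) := by ring
      linarith
    nlinarith [mul_le_mul_of_nonneg_left (h4.trans h3) hkα.le]
  refine ⟨k, rfl, by omega, ?_, ?_, ?_, ?_⟩
  · intro i hi hik
    apply Nat.le_floor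
    have h5 : (0:ℝ) < (i : ℝ) ^ α := Real.rpow_pos_of_pos (by exact_mod_cast hi) _
    rw [Nat.cast_one, one_le_div h5]
    refine le_trans (Real.rpow_le_rpow (by positivity) (by exact_mod_cast hik) (by linarith)) hkC
  · intro i hi
    rw [Nat.floor_eq_zero]
    have hi0 : 0 < i := by omega
    have h5 : (0:ℝ) < (i : ℝ) ^ α := Real.rpow_pos_of_pos (by exact_mod_cast hi0) _
    rw [div_lt_one h5]
    have h6 : ((2 * k : ℕ) : ℝ) ^ α ≤ (i:ℝ)^α :=
      Real.rpow_le_rpow (by positivity) (by exact_mod_cast hi.le) (by linarith)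
    push_cast at h6
    rw [Real.mul_rpow (by norm_num) hkpos.le] at h6
    have h7 : (2:ℝ) ≤ 2 ^ α := by
      have := Real.rpow_le_rpow_of_exponent_le (show (1:ℝ) ≤ 2 by norm_num) (show 1 ≤ α by linarith)
      simpa using this
    nlinarith
  · apply Nat.le_floor
    refine le_trans ?_ hkC
    have h1 : (k:ℝ)^α = (k:ℝ)^(α-2) * k^2 := by
      rw [← Real.rpow_natCast, ← Real.rpow_add hkpos]; norm_num
    have h2 : (25:ℝ) ≤ (k:ℝ)^(α-2) :=
      hB2.trans (Real.rpow_le_rpow (by positivity) hBk.le (by linarith))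
    rw [h1]
    push_cast
    nlinarith [sq_nonneg (k:ℝ)]
  · have hs : Summable (fun j : ℕ => ((j : ℝ) + 1) ^ (-α)) := by
      have := (summable_nat_add_iff 1).2 (Real.summable_nat_rpow.2 (show -α < -1 by linarith))
      simpa using this
    have hz1 : ∑ j ∈ Finset.range (2 * k), ((j : ℝ) + 1) ^ (-α) ≤ zetaR α :=
      hs.sum_le_tsum _ (fun j _ => by positivity)
    have hzpos : 0 < zetaR α := by
      refine lt_of_lt_of_le ?_ hz1
      apply Finset.sum_pos
      · intro j _; positivity
      · simp; omega
    have hCz' : C * zetaR α ≤ 1 := by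
      rwa [le_div_iff₀ hzpos] at hCz
    have h1 : ∑ i ∈ Finset.Icc 1 (2 * k), ⌊C * (n : ℝ) / (i : ℝ) ^ α⌋₊
      = ∑ j ∈ Finset.range (2 * k), ⌊C * (n : ℝ) / ((j + 1 : ℕ) : ℝ) ^ α⌋₊ := by
      rw [Finset.range_eq_Ico, Finset.sum_Ico_add' (fun i : ℕ => ⌊C * (n : ℝ) / (i : ℝ) ^ α⌋₊) 0 (2*k) 1]
      rfl
    rw [h1]
    have h2 : ((∑ j ∈ Finset.range (2 * k), ⌊C * (n : ℝ) / ((j + 1 : ℕ) : ℝ) ^ α⌋₊ : ℕ) : ℝ)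
        ≤ ∑ j ∈ Finset.range (2 * k), C * n * ((j : ℝ) + 1) ^ (-α) := by
      push_cast
      apply Finset.sum_le_sum
      intro j _
      refine (Nat.floor_le (by positivity)).trans ?_
      rw [Real.rpow_neg (by positivity), div_eq_mul_inv]
    rw [← Finset.mul_sum] at h2
    have h3 : C * n * ∑ j ∈ Finset.range (2 * k), ((j : ℝ) + 1) ^ (-α) ≤ n := by
      calc _ ≤ C * n * zetaR α := mul_le_mul_of_nonneg_left hz1 hCn
        _ = n * (C * zetaR α) := by ring
        _ ≤ n * 1 := mul_le_mul_of_nonneg_left hCz' (by positivity)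
        _ = n := by ring
    exact_mod_cast h2.trans h3

theorem construct (n k : ℕ) (c : ℕ → ℕ) (hsum : ∑ i ∈ Finset.range (2 * k + 1), c i = n)
    (heven : Even (∑ i ∈ Finset.range (2 * k + 1), i * c i))
    (hc : ∀ i, k ≤ i → i ≤ 2 * k → 1 ≤ c i) (hk : 1 ≤ k)
    (hbig : (5 * k + 3) * (2 * k + 1) < c 1) (H : SimpleGraph (Fin (k + 1))) :
    ∃ G : SimpleGraph (Fin n), ∃ f : Fin (k + 1) → Fin n, Function.Injective f ∧
      (∀ u v, G.Adj (f u) (f v) ↔ H.Adj u v) ∧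
      ∀ i, Vcard G i = if i ≤ 2 * k then c i else 0 := by
  classical
  have hcard : Fintype.card (Σ i : Fin (2 * k + 1), Fin (c i)) = n := by
    rw [Fintype.card_sigma]
    simp only [Fintype.card_fin]
    rw [Fin.sum_univ_eq_sum_range c (2 * k + 1), hsum]
  let e : (Σ i : Fin (2 * k + 1), Fin (c i)) ≃ Fin n := Fintype.equivFinOfCardEq hcard
  let t : Fin n → ℕ := fun v => ((e.symm v).1 : ℕ)
  have htD : ∀ v, t v ≤ 2 * k := fun v => by
    have := (e.symm v).1.2
    show ((e.symm v).1 : ℕ) ≤ 2 * k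
    omega
  let f : Fin (k + 1) → Fin n := fun j =>
    e ⟨⟨k + j, by have := j.2; omega⟩, ⟨0, hc _ (by simp) (by have := j.2; simp; omega)⟩⟩
  have htf : ∀ j, t (f j) = k + j := fun j => by simp [t, f]
  have hf : Function.Injective f := by
    intro a b hab
    have : t (f a) = t (f b) := by rw [hab]
    rw [htf, htf] at this
    exact Fin.ext (by omega)
  -- fibre sizes
  have hfib : ∀ i, (Finset.univ.filter (fun v => t v = i)).card = if i ≤ 2 * k then c i else 0 := by
    intro i
    split_ifs with hi
    · have h1 : Finset.univ.filter (fun v => t v = i) =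
          (Finset.univ : Finset (Fin (c i))).map
            ⟨fun x => e ⟨⟨i, by omega⟩, x⟩, fun x y h => by
              have := e.injective h
              simpa using this⟩ := by
        ext v
        simp only [Finset.mem_filter, Finset.mem_univ, true_and, Finset.mem_map]
        constructor
        · intro hv
          obtain ⟨⟨a, x⟩, rfl⟩ := e.surjective v
          simp only [t, Equiv.symm_apply_apply] at hv
          subst hv
          exact ⟨x, rfl⟩
        · rintro ⟨x, rfl⟩
          show ((e.symm (e ⟨⟨i, by omega⟩, x⟩)).1 : ℕ) = i
          simp
      rw [h1, Finset.card_map, Finset.card_univ, Fintype.card_fin]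
    · rw [Finset.card_eq_zero, Finset.filter_eq_empty_iff]
      intro v _ hv
      exact hi (hv ▸ htD v)
  have hsumt : ∑ v, t v = ∑ i ∈ Finset.range (2 * k + 1), i * c i := by
    rw [← Equiv.sum_comp e t, Fintype.sum_sigma, ← Fin.sum_univ_eq_sum_range (fun i => i * c i)]
    apply Finset.sum_congr rfl
    intro i _
    simp [t, mul_comm]
  let S : Finset (Fin n) := Finset.univ.image f
  have hS : S.card = k + 1 := by
    rw [Finset.card_image_of_injective _ hf, Finset.card_univ, Fintype.card_fin]
  let H' : SimpleGraph (Fin n) := H.map f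
  have hHt : ∀ v, deg H' v ≤ t v := by
    intro v
    by_cases hv : ∃ j, f j = v
    · obtain ⟨j, rfl⟩ := hv
      rw [htf]
      have h1 : H'.neighborSet (f j) ⊆ f '' (H.neighborSet j) := by
        intro w hw
        simp only [SimpleGraph.mem_neighborSet, H', SimpleGraph.map_adj] at hw
        obtain ⟨_, a, b, hab, h1, h2⟩ := hw
        have : a = j := hf h1
        subst this
        exact ⟨b, hab, h2⟩
      have h2 : deg H' (f j) ≤ (f '' (H.neighborSet j)).ncard := Set.ncard_le_ncard h1 (Set.toFinite _)
      rw [Set.ncard_image_of_injective _ hf] at h2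
      have h3 : (H.neighborSet j).ncard = deg H j := rfl
      have h5 := deg_eq_degree H j
      rw [h3] at h2
      have h4 := H.degree_lt_card_verts j
      rw [Fintype.card_fin] at h4
      omega
    · have : H'.neighborSet v = ∅ := by
        ext w
        simp only [SimpleGraph.mem_neighborSet, H', SimpleGraph.map_adj, Set.mem_empty_iff_false,
          iff_false]
        rintro ⟨_, a, b, hab, h1, h2⟩
        exact hv ⟨a, h1⟩
      rw [deg, this]; simp
  obtain ⟨G, hG1, hG2⟩ := realize S H' t (2 * k) htD hHt (hsumt ▸ heven) (by
    rw [hS]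
    have h1 : (Finset.univ.filter (fun v => t v = 1)).card ≤
        (Finset.univ.filter (fun v => 1 ≤ t v)).card := by
      apply Finset.card_le_card
      intro v
      simp only [Finset.mem_filter, Finset.mem_univ, true_and]
      omega
    rw [hfib, if_pos (by omega)] at h1
    have h2 : k + 1 + 2 * (2 * k) + 2 = 5 * k + 3 := by ring
    rw [h2]
    omega)
  refine ⟨G, f, hf, ?_, ?_⟩
  · intro u v
    rw [hG1 (f u) (by simp [S]) (f v) (by simp [S])]
    exact SimpleGraph.map_adj_apply (f := ⟨f, hf⟩) (G := H) (a := u) (b := v)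
  · intro i
    rw [← hfib i, Vcard, Set.ncard_eq_toFinset_card']
    congr 1
    ext v
    simp [hG2]

theorem exists_powerlaw (α C : ℝ) (hC : 0 < C) (hα : 2 < α) (n k : ℕ) (hk : k = i1 α C n) (hk3 : 3 ≤ k)
    (h1 : ∀ i : ℕ, 0 < i → i ≤ k → 1 ≤ ⌊C * (n : ℝ) / (i : ℝ) ^ α⌋₊)
    (h2 : ∀ i : ℕ, 2 * k < i → ⌊C * (n : ℝ) / (i : ℝ) ^ α⌋₊ = 0)
    (h3 : (5 * k + 3) * (2 * k + 1) + k + 2 ≤ ⌊C * (n : ℝ)⌋₊)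
    (h4 : ∑ i ∈ Finset.Icc 1 (2 * k), ⌊C * (n : ℝ) / (i : ℝ) ^ α⌋₊ ≤ n)
    (H : SimpleGraph (Fin (k + 1))) :
    ∃ G : SimpleGraph (Fin n), ∃ f : Fin (k + 1) → Fin n, Function.Injective f ∧
      (∀ u v, G.Adj (f u) (f v) ↔ H.Adj u v) ∧ IsProperPowerLaw α C G := by
  have hCn : 0 ≤ C * (n : ℝ) := by positivity
  have hnpos : 0 < C * (n : ℝ) := by
    by_contra! h
    have : ⌊C * (n : ℝ)⌋₊ = 0 := Nat.floor_eq_zero.2 (by linarith)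
    omega
  set q : ℕ → ℕ := fun i => ⌊C * (n : ℝ) / (i : ℝ) ^ α⌋₊ with hq
  have hq1 : q 1 = ⌊C * (n : ℝ)⌋₊ := by simp [hq]
  have hqmono : ∀ i j : ℕ, 0 < i → i ≤ j → q j ≤ q i := by
    intro i j hi hij
    apply Nat.floor_le_floor
    have hi' : (0:ℝ) < i := by exact_mod_cast hi
    apply div_le_div_of_nonneg_left hCn (Real.rpow_pos_of_pos hi' _)
    exact Real.rpow_le_rpow hi'.le (by exact_mod_cast hij) (by linarith)
  have hqi : ∀ i : ℕ, (q i : ℤ) = ⌊C * (n : ℝ) / (i : ℝ) ^ α⌋ := fun i =>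
    Int.natCast_floor_eq_floor (by positivity)
  -- choose the parity correction
  let R : ℕ := ∑ i ∈ Finset.Icc 2 (2 * k), i * max (q i) 1
  obtain ⟨ε, hε, hpar⟩ : ∃ ε : ℕ, ε ≤ 1 ∧ Even (q 1 - k - 1 + ε + R) := by
    rcases Nat.even_or_odd (q 1 - k - 1 + R) with h | h
    · exact ⟨0, by omega, by simpa using h⟩
    · refine ⟨1, le_refl _, ?_⟩
      have := h.add_one
      rwa [show q 1 - k - 1 + 1 + R = q 1 - k - 1 + R + 1 by ring]
  let b : ℕ → ℕ := fun i => if i = 1 then q 1 - k - 1 + ε else max (q i) 1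
  have hkk : Finset.Icc 1 (2 * k) = insert 1 (Finset.Icc 2 (2 * k)) := by
    ext x; simp; omega
  have hb1 : b 1 = q 1 - k - 1 + ε := by simp [b]
  have hb2 : ∀ i, 2 ≤ i → b i = max (q i) 1 := fun i hi => by
    simp only [b]; rw [if_neg (by omega)]
  have hT : ∑ i ∈ Finset.Icc 1 (2 * k), b i ≤ n := by
    have hle : ∑ i ∈ Finset.Icc 1 (2 * k), (b i + if i = 1 then k else 0) ≤
        ∑ i ∈ Finset.Icc 1 (2 * k), (q i + if k < i then 1 else 0) := by
      apply Finset.sum_le_sum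
      intro i hi
      rw [Finset.mem_Icc] at hi
      by_cases h : i = 1
      · subst h; rw [hb1]; simp; omega
      · rw [hb2 i (by omega)]
        by_cases hki : k < i
        · simp [h, hki]
        · have : 1 ≤ q i := h1 i (by omega) (by omega)
          simp [h, hki]; omega
    rw [Finset.sum_add_distrib, Finset.sum_add_distrib] at hle
    have e1 : (∑ i ∈ Finset.Icc 1 (2 * k), if i = 1 then k else 0) = k := by
      rw [Finset.sum_ite_eq']; simp; omega
    have e2 : (∑ i ∈ Finset.Icc 1 (2 * k), if k < i then 1 else 0) = k := by
      rw [← Finset.card_filter]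
      have : Finset.filter (fun i => k < i) (Finset.Icc 1 (2 * k)) = Finset.Ioc k (2 * k) := by
        ext x; simp; omega
      rw [this]; simp; omega
    rw [e1, e2] at hle
    have h4' : ∑ i ∈ Finset.Icc 1 (2 * k), q i ≤ n := h4
    omega
  let c : ℕ → ℕ := fun i => if i = 0 then n - ∑ i ∈ Finset.Icc 1 (2 * k), b i else b i
  have hrange : Finset.range (2 * k + 1) = insert 0 (Finset.Icc 1 (2 * k)) := by
    ext x; simp; omega
  have hcb : ∀ i, 1 ≤ i → c i = b i := fun i hi => by
    simp only [c]; rw [if_neg (by omega)]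
  obtain ⟨G, f, hf, hadj, hV⟩ := construct n k c (by
      rw [hrange, Finset.sum_insert (by simp), Finset.sum_congr rfl
        (fun i hi => hcb i (Finset.mem_Icc.1 hi).1)]
      have hc0 : c 0 = n - ∑ i ∈ Finset.Icc 1 (2 * k), b i := if_pos rfl
      rw [hc0]; exact Nat.sub_add_cancel hT) (by
      rw [hrange, Finset.sum_insert (by simp), Finset.sum_congr rfl
        (fun i hi => by rw [hcb i (Finset.mem_Icc.1 hi).1]), hkk, Finset.sum_insert (by simp),
        Finset.sum_congr rfl (fun i hi => by rw [hb2 i (Finset.mem_Icc.1 hi).1]), hb1]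
      simpa using hpar) (fun i hi _ => by
      rw [hcb i (by omega), hb2 i (by omega)]; exact le_max_right _ _) (by omega) (by
      rw [hcb 1 le_rfl, hb1, hq1]; omega) H
  refine ⟨G, f, hf, hadj, ?_⟩
  have hV1 : Vcard G 1 = q 1 - k - 1 + ε := by
    rw [hV, if_pos (by omega), hcb 1 le_rfl, hb1]
  have hV2 : ∀ i, 2 ≤ i → i ≤ 2 * k → Vcard G i = max (q i) 1 := fun i hi hi' => by
    rw [hV, if_pos hi', hcb i (by omega), hb2 i hi]
  have hV3 : ∀ i, 2 * k < i → Vcard G i = 0 := fun i hi => by rw [hV, if_neg (by omega)]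
  refine ⟨?_, ?_, ?_, ?_⟩
  · have h5 := hqi 1
    simp only [Nat.cast_one, Real.one_rpow, div_one] at h5
    have h6 := Int.floor_le_ceil (C * (n : ℝ))
    rw [← hk, hV1]
    omega
  · have h5 := hqi 2
    push_cast at h5
    have h6 := Int.floor_le_ceil (C * (n : ℝ) / (2 : ℝ) ^ α)
    have h7 : 1 ≤ q 2 := h1 2 (by omega) (by omega)
    rw [hV2 2 le_rfl (by omega), max_eq_left h7]
    omega
  · intro i hi3 hin
    by_cases hi : i ≤ 2 * k
    · rw [hV2 i (by omega) hi]
      by_cases h0 : 1 ≤ q i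
      · left; rw [max_eq_left h0, hqi]
      · right
        rw [max_eq_right (by omega)]
        have h5 : q i = 0 := by omega
        have h6 := Nat.floor_eq_zero.1 h5
        symm
        rw [Int.ceil_eq_iff]
        have hi' : (0:ℝ) < i := by exact_mod_cast (show 0 < i by omega)
        have h7 : 0 < C * (n : ℝ) / (i : ℝ) ^ α := div_pos hnpos (Real.rpow_pos_of_pos hi' _)
        constructor
        · simpa using h7
        · simpa using h6.le
    · left
      rw [hV3 i (by omega), ← hqi]
      have : q i = 0 := h2 i (by omega)
      rw [this]
  · intro i hi _
    by_cases hi' : i + 1 ≤ 2 * k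
    · rw [hV2 i hi (by omega), hV2 (i+1) (by omega) hi']
      exact max_le_max (hqmono i (i+1) (by omega) (by omega)) le_rfl
    · rw [hV3 (i+1) (by omega)]; exact Nat.zero_le _

theorem stmt7 (α C : ℝ) (hα : 2 < α) (hC : 0 < C) (hCz : C ≤ 1 / zetaR α) :
    ∃ N : ℕ, ∀ n : ℕ, N ≤ n →
      ¬ ∃ D : List Bool → List Bool → Bool,
        ∀ G : SimpleGraph (Fin n), IsProperPowerLaw α C G →
          ∃ ℓ : Fin n → List Bool,
            (∀ v : Fin n, (ℓ v).length < i1 α C n / 2) ∧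
            ∀ u v : Fin n, u ≠ v → (D (ℓ u) (ℓ v) = true ↔ G.Adj u v) := by
  obtain ⟨N, hN⟩ := numeric α C hα hC hCz
  refine ⟨N, fun n hn => ?_⟩
  rintro ⟨D, hD⟩
  obtain ⟨k, hk, hk3, h1, h2, h3, h4⟩ := hN n hn
  rw [← hk] at hD
  apply counting k (k / 2) (by omega) D
  intro H
  obtain ⟨G, f, hf, hadj, hG⟩ := exists_powerlaw α C hC hα n k hk hk3 h1 h2 h3 h4 H
  obtain ⟨ℓ, hl1, hl2⟩ := hD G hG
  refine ⟨fun v => ℓ (f v), fun v => hl1 _, fun u v huv => ?_⟩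
  rw [hl2 _ _ (fun h => huv (hf h)), hadj]
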